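/- arXiv:1610.03595 — 6 statements merged into one kernel-verified Lean document; each statement's English description precedes it below -/
import Mathlib

section
/- For every real z and every real s with s ≠ 0, s ≠ σ_ℓ² for all ℓ, and Q(s, z) = 0, one has (c − 1) + 2·c·z²/s − c·Σ_{ℓ=1}^L p_ℓ s²/(s − σ_ℓ²)² = A(s). -/
/-- Completing the square: `s² = 2 s (s - a) - (s - a)² + a²`, divided by `(s - a)²` and averaged
against the weights `p`. -/
theorem sum_mul_sq_div_sub_sq {ι K : Type*} [Fintype ι] [Field K] (a p : ι → K) (s : K)
    (hs : ∀ i, s ≠ a i) :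
    ∑ i, p i * s ^ 2 / (s - a i) ^ 2 =
      2 * s * ∑ i, p i / (s - a i) - ∑ i, p i + ∑ i, p i * a i ^ 2 / (s - a i) ^ 2 := by
  rw [Finset.mul_sum, ← Finset.sum_sub_distrib, ← Finset.sum_add_distrib]
  refine Finset.sum_congr rfl fun i _ => ?_
  have h : s - a i ≠ 0 := sub_ne_zero.mpr (hs i)
  field_simp
  ring

/-- If `Q(s,z) = 0` then `(c-1) + 2 c z²/s - c ∑ p s²/(s - σ²)² = A(s)`. -/
theorem stmt_3 (L : ℕ) (hL : 0 < L) (c : ℝ) (hc : 1 < c)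
    (σ p : Fin L → ℝ) (hσ : ∀ ℓ, 0 < σ ℓ) (hp : ∀ ℓ, 0 < p ℓ)
    (hpsum : ∑ ℓ, p ℓ = 1)
    (A : ℝ → ℝ)
    (hA : ∀ x : ℝ, A x = 1 - c * ∑ ℓ, p ℓ * σ ℓ ^ 4 / (x - σ ℓ ^ 2) ^ 2)
    (Q : ℝ → ℝ → ℝ)
    (hQ : ∀ s z : ℝ, Q s z = c * z ^ 2 / s ^ 2 + (c - 1) / s
      - c * ∑ ℓ, p ℓ / (s - σ ℓ ^ 2)) :
    ∀ z s : ℝ, s ≠ 0 → (∀ ℓ, s ≠ σ ℓ ^ 2) → Q s z = 0 →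
      (c - 1) + 2 * c * z ^ 2 / s - c * ∑ ℓ, p ℓ * s ^ 2 / (s - σ ℓ ^ 2) ^ 2 = A s := by
  intro z s hs0 hs hQ0
  rw [hQ] at hQ0
  have hz : c * z ^ 2 / s + (c - 1) = c * s * ∑ ℓ, p ℓ / (s - σ ℓ ^ 2) := by
    field_simp at hQ0 ⊢
    linear_combination hQ0
  have hpow : ∀ ℓ, (σ ℓ ^ 2) ^ 2 = σ ℓ ^ 4 := fun ℓ => by ring
  rw [hA, sum_mul_sq_div_sub_sq (fun ℓ => σ ℓ ^ 2) p s hs, hpsum]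
  simp only [hpow]
  linear_combination 2 * hz
end

section
/- Let U ⊆ ℝ be an open set, z₀ ∈ U, and ψ : ℝ → ℝ a function such that for all z ∈ U one has ψ(z) ≠ 0, ψ(z) ≠ σ_ℓ² for all ℓ, and Q(ψ(z), z) = 0. If ψ has derivative d at z₀ (in the sense of HasDerivAt) and A(ψ(z₀)) ≠ 0, then d = 2·c·z₀ / A(ψ(z₀)). -/
/-- Implicit differentiation: if `ψ` satisfies `Q(ψ z, z) = 0` on an open set `U`,
`ψ` has derivative `d` at `z₀ ∈ U`, and `A(ψ z₀) ≠ 0`, then `d = 2 c z₀ / A(ψ z₀)`. -/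
theorem stmt_4 (L : ℕ) (hL : 0 < L) (c : ℝ) (hc : 1 < c)
    (σ p : Fin L → ℝ) (hσ : ∀ ℓ, 0 < σ ℓ) (hp : ∀ ℓ, 0 < p ℓ)
    (hpsum : ∑ ℓ, p ℓ = 1)
    (A : ℝ → ℝ)
    (hA : ∀ x : ℝ, A x = 1 - c * ∑ ℓ, p ℓ * σ ℓ ^ 4 / (x - σ ℓ ^ 2) ^ 2)
    (Q : ℝ → ℝ → ℝ)
    (hQ : ∀ s z : ℝ, Q s z = c * z ^ 2 / s ^ 2 + (c - 1) / s
      - c * ∑ ℓ, p ℓ / (s - σ ℓ ^ 2))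
    (U : Set ℝ) (hU : IsOpen U) (z₀ : ℝ) (hz₀ : z₀ ∈ U)
    (ψ : ℝ → ℝ)
    (hψ0 : ∀ z ∈ U, ψ z ≠ 0)
    (hψσ : ∀ z ∈ U, ∀ ℓ, ψ z ≠ σ ℓ ^ 2)
    (hψQ : ∀ z ∈ U, Q (ψ z) z = 0)
    (d : ℝ) (hd : HasDerivAt ψ d z₀)
    (hAne : A (ψ z₀) ≠ 0) :
    d = 2 * c * z₀ / A (ψ z₀) := by
  have key : ∀ z ∈ U,
      c * z ^ 2 - ψ z - c * ∑ ℓ, p ℓ * (σ ℓ ^ 2 + σ ℓ ^ 4 / (ψ z - σ ℓ ^ 2)) = 0 := by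
    intro z hz
    have hs := hψ0 z hz
    have hsum : ψ z ^ 2 * ∑ ℓ, p ℓ / (ψ z - σ ℓ ^ 2)
        = ψ z + ∑ ℓ, p ℓ * (σ ℓ ^ 2 + σ ℓ ^ 4 / (ψ z - σ ℓ ^ 2)) := by
      calc ψ z ^ 2 * ∑ ℓ, p ℓ / (ψ z - σ ℓ ^ 2)
          = ∑ ℓ, (p ℓ * ψ z + p ℓ * (σ ℓ ^ 2 + σ ℓ ^ 4 / (ψ z - σ ℓ ^ 2))) := by
            rw [Finset.mul_sum]
            refine Finset.sum_congr rfl fun ℓ _ => ?_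
            have h := sub_ne_zero.mpr (hψσ z hz ℓ)
            field_simp
            ring
        _ = _ := by rw [Finset.sum_add_distrib, ← Finset.sum_mul, hpsum, one_mul]
    have hQz : ψ z ^ 2 * Q (ψ z) z = c * z ^ 2 + (c - 1) * ψ z
        - c * (ψ z ^ 2 * ∑ ℓ, p ℓ / (ψ z - σ ℓ ^ 2)) := by
      rw [hQ]
      field_simp
    rw [hψQ z hz, hsum] at hQz
    linarith
  have hderiv : HasDerivAt
      (fun z => c * z ^ 2 - ψ z - c * ∑ ℓ, p ℓ * (σ ℓ ^ 2 + σ ℓ ^ 4 / (ψ z - σ ℓ ^ 2)))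
      (c * (2 * z₀) - d
        - c * ∑ ℓ, p ℓ * (-(σ ℓ ^ 4 * d) / (ψ z₀ - σ ℓ ^ 2) ^ 2)) z₀ := by
    have hsq : HasDerivAt (fun z : ℝ => z ^ 2) (2 * z₀) z₀ := by
      simpa using hasDerivAt_pow 2 z₀
    refine ((hsq.const_mul c).sub hd).sub
      ((HasDerivAt.fun_sum fun ℓ _ => ?_).const_mul c)
    refine HasDerivAt.const_mul _ (HasDerivAt.const_add _ ?_)
    have h := (hasDerivAt_const z₀ (σ ℓ ^ 4)).fun_div (hd.sub_const (σ ℓ ^ 2))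
      (sub_ne_zero.mpr (hψσ z₀ hz₀ ℓ))
    simpa using h
  have hzero := hderiv.unique ((hasDerivAt_const z₀ (0 : ℝ)).congr_of_eventuallyEq
    (Filter.eventually_of_mem (hU.mem_nhds hz₀) key))
  have hsum : ∑ ℓ, p ℓ * (-(σ ℓ ^ 4 * d) / (ψ z₀ - σ ℓ ^ 2) ^ 2)
      = -d * ∑ ℓ, p ℓ * σ ℓ ^ 4 / (ψ z₀ - σ ℓ ^ 2) ^ 2 := by
    rw [Finset.mul_sum]
    exact Finset.sum_congr rfl fun ℓ _ => by ring
  rw [eq_div_iff hAne, hA]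
  rw [hsum] at hzero
  linarith
end

section
/- On the interval (σ_max², ∞) the function A is strictly monotonically increasing, tends to −∞ as x → σ_max² from the right, and tends to 1 as x → ∞; consequently there is a unique α ∈ (σ_max², ∞) with A(α) = 0, and A(x) < 0 for x ∈ (σ_max², α) while A(x) > 0 for x ∈ (α, ∞). -/
open Set Filter

section InverseSquareSum

variable {ι : Type*} [Fintype ι] {w a : ι → ℝ} {s : ℝ}

theorem strictAntiOn_sum_div_sub_sq [Nonempty ι] (hw : ∀ i, 0 < w i) (ha : ∀ i, a i ≤ s) :
    StrictAntiOn (fun x => ∑ i, w i / (x - a i) ^ 2) (Ioi s) := by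
  intro x hx y _ hxy
  refine Finset.sum_lt_sum_of_nonempty Finset.univ_nonempty fun i _ => ?_
  have hxi : 0 < x - a i := sub_pos.2 ((ha i).trans_lt hx)
  have := hw i
  gcongr

theorem continuousOn_sum_div_sub_sq (ha : ∀ i, a i ≤ s) :
    ContinuousOn (fun x => ∑ i, w i / (x - a i) ^ 2) (Ioi s) := by
  refine continuousOn_finsetSum _ fun i _ => ContinuousOn.div (by fun_prop) (by fun_prop) ?_
  intro x hx
  exact pow_ne_zero 2 (sub_pos.2 ((ha i).trans_lt hx)).ne'

theorem tendsto_sum_div_sub_sq_atTop :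
    Tendsto (fun x => ∑ i, w i / (x - a i) ^ 2) atTop (nhds 0) := by
  rw [← Finset.sum_const_zero (s := (Finset.univ : Finset ι))]
  refine tendsto_finsetSum _ fun i _ => Tendsto.div_atTop tendsto_const_nhds ?_
  exact (tendsto_pow_atTop two_ne_zero).comp (tendsto_atTop_add_const_right _ (-a i) tendsto_id)

theorem tendsto_sum_div_sub_sq_nhdsGT (hw : ∀ i, 0 < w i) (j : ι) (hj : a j = s) :
    Tendsto (fun x => ∑ i, w i / (x - a i) ^ 2) (nhdsWithin s (Ioi s)) atTop := by
  have hsq : Tendsto (fun x => (x - s) ^ 2) (nhdsWithin s (Ioi s)) (nhdsWithin 0 (Ioi 0)) := by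
    refine tendsto_nhdsWithin_iff.2 ⟨?_, ?_⟩
    · have : ContinuousAt (fun x => (x - s) ^ 2) s := by fun_prop
      simpa using this.tendsto.mono_left nhdsWithin_le_nhds
    · filter_upwards [self_mem_nhdsWithin] with x hx
      exact mem_Ioi.2 (pow_pos (sub_pos.2 (mem_Ioi.1 hx)) 2)
  refine tendsto_atTop_mono (fun x => ?_) (hsq.inv_tendsto_nhdsGT_zero.const_mul_atTop (hw j))
  have := Finset.single_le_sum (f := fun i => w i / (x - a i) ^ 2)
    (fun i _ => div_nonneg (hw i).le (sq_nonneg _)) (Finset.mem_univ j)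
  simpa [hj, div_eq_mul_inv] using this

end InverseSquareSum

/-- On `(σ_max², ∞)` the function `A` is strictly increasing, tends to `-∞` at
`σ_max²⁺` and to `1` at `∞`; consequently `A` has a unique zero `α` there, with
`A < 0` on `(σ_max², α)` and `A > 0` on `(α, ∞)`. -/
theorem stmt_5 (L : ℕ) (hL : 0 < L) (c : ℝ) (hc : 1 < c)
    (σ p : Fin L → ℝ) (hσ : ∀ ℓ, 0 < σ ℓ) (hp : ∀ ℓ, 0 < p ℓ)
    (hpsum : ∑ ℓ, p ℓ = 1)
    (A : ℝ → ℝ)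
    (hA : ∀ x : ℝ, A x = 1 - c * ∑ ℓ, p ℓ * σ ℓ ^ 4 / (x - σ ℓ ^ 2) ^ 2)
    (smax : ℝ)
    (hsmax : smax = Finset.univ.sup' ⟨⟨0, hL⟩, Finset.mem_univ _⟩ (fun ℓ => σ ℓ ^ 2)) :
    StrictMonoOn A (Ioi smax) ∧
    Tendsto A (nhdsWithin smax (Ioi smax)) atBot ∧
    Tendsto A atTop (nhds 1) ∧
    (∃! α : ℝ, α ∈ Ioi smax ∧ A α = 0) ∧
    (∀ α : ℝ, α ∈ Ioi smax → A α = 0 →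
      (∀ x ∈ Ioo smax α, A x < 0) ∧ (∀ x ∈ Ioi α, 0 < A x)) := by
  obtain rfl : A = _ := funext hA
  have : Nonempty (Fin L) := ⟨⟨0, hL⟩⟩
  have hc0 : 0 < c := one_pos.trans hc
  have hw : ∀ ℓ, 0 < p ℓ * σ ℓ ^ 4 := fun ℓ => mul_pos (hp ℓ) (pow_pos (hσ ℓ) 4)
  have ha : ∀ ℓ, σ ℓ ^ 2 ≤ smax := fun ℓ =>
    hsmax ▸ Finset.le_sup' (fun ℓ => σ ℓ ^ 2) (Finset.mem_univ ℓ)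
  obtain ⟨j, -, hj⟩ := Finset.exists_mem_eq_sup' (s := (Finset.univ : Finset (Fin L)))
    ⟨⟨0, hL⟩, Finset.mem_univ _⟩ (fun ℓ => σ ℓ ^ 2)
  set A : ℝ → ℝ := fun x => 1 - c * ∑ ℓ, p ℓ * σ ℓ ^ 4 / (x - σ ℓ ^ 2) ^ 2
  have hmono : StrictMonoOn A (Ioi smax) := fun x hx y hy hxy =>
    sub_lt_sub_left (mul_lt_mul_of_pos_left (strictAntiOn_sum_div_sub_sq hw ha hx hy hxy) hc0) 1
  have hbot : Tendsto A (nhdsWithin smax (Ioi smax)) atBot :=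
    tendsto_atBot_add_const_left _ 1 (tendsto_neg_atTop_atBot.comp
      ((tendsto_sum_div_sub_sq_nhdsGT hw j (hsmax.trans hj).symm).const_mul_atTop hc0))
  have htop : Tendsto A atTop (nhds 1) := by
    simpa using (tendsto_sum_div_sub_sq_atTop (w := fun ℓ => p ℓ * σ ℓ ^ 4)
      (a := fun ℓ => σ ℓ ^ 2)).const_mul c |>.const_sub 1
  have hcont : ContinuousOn A (Ioi smax) :=
    continuousOn_const.sub (continuousOn_const.mul (continuousOn_sum_div_sub_sq ha))
  refine ⟨hmono, hbot, htop, ?_, fun α hα h0 => ⟨fun x hx => ?_, fun x hx => ?_⟩⟩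
  · obtain ⟨x, hx, hxs⟩ := ((hbot.eventually_lt_atBot 0).and self_mem_nhdsWithin).exists
    obtain ⟨y, hy, hys⟩ := ((htop.eventually_const_lt one_pos).and (Ioi_mem_atTop smax)).exists
    obtain ⟨α, hα, h0⟩ := isPreconnected_Ioi.intermediate_value hxs hys hcont ⟨hx.le, hy.le⟩
    exact ⟨α, ⟨hα, h0⟩, fun β hβ => hmono.injOn hβ.1 hα (hβ.2.trans h0.symm)⟩
  · exact h0 ▸ hmono hx.1 hα hx.2
  · exact h0 ▸ hmono hα (mem_Ioi.2 (lt_trans hα hx)) hx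
end

section
/- On the interval (σ_max², ∞) the function B is strictly monotonically increasing, tends to −∞ as x → σ_max² from the right, and tends to 1 as x → ∞; consequently there is a unique β ∈ (σ_max², ∞) with B(β) = 0, B(x) < 0 for x ∈ (σ_max², β), B(x) > 0 for x ∈ (β, ∞), and moreover every real x with x ≠ σ_ℓ² for all ℓ and B(x) = 0 satisfies x ≤ β (i.e., β is the largest real root of B). -/
open Set Filter

section PoleSum

variable {ι : Type*} [Fintype ι] {w a : ι → ℝ} {m : ℝ}

theorem strictAntiOn_sum_div_sub [Nonempty ι] (hw : ∀ i, 0 < w i) (ha : ∀ i, a i ≤ m) :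
    StrictAntiOn (fun x => ∑ i, w i / (x - a i)) (Ioi m) := by
  intro x hx y _ hxy
  refine Finset.sum_lt_sum_of_nonempty Finset.univ_nonempty fun i _ => ?_
  have hxi : 0 < x - a i := sub_pos.2 ((ha i).trans_lt hx)
  exact div_lt_div_of_pos_left (hw i) hxi (by linarith)

theorem continuousOn_sum_div_sub (ha : ∀ i, a i ≤ m) :
    ContinuousOn (fun x => ∑ i, w i / (x - a i)) (Ioi m) := by
  refine continuousOn_finsetSum _ fun i _ => ?_
  refine continuousOn_const.div (by fun_prop) fun x hx => ?_
  exact (sub_pos.2 ((ha i).trans_lt hx)).ne'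

theorem tendsto_sum_div_sub_atTop :
    Tendsto (fun x => ∑ i, w i / (x - a i)) atTop (nhds 0) := by
  rw [← Finset.sum_const_zero (s := (Finset.univ : Finset ι))]
  refine tendsto_finsetSum _ fun i _ => ?_
  exact (tendsto_atTop_add_const_right _ (-a i) tendsto_id).const_div_atTop (w i)

theorem tendsto_sum_div_sub_nhdsGT (hw : ∀ i, 0 < w i) (ha : ∀ i, a i ≤ m)
    (hm : ∃ j, a j = m) :
    Tendsto (fun x => ∑ i, w i / (x - a i)) (nhdsWithin m (Ioi m)) atTop := by
  obtain ⟨j, hj⟩ := hm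
  have hsub : Tendsto (fun x => x - m) (nhdsWithin m (Ioi m)) (nhdsWithin 0 (Ioi 0)) := by
    refine tendsto_nhdsWithin_iff.2 ⟨?_, ?_⟩
    · have h : ContinuousAt (fun x : ℝ => x - m) m := by fun_prop
      simpa [ContinuousAt] using h.tendsto.mono_left nhdsWithin_le_nhds
    · filter_upwards [self_mem_nhdsWithin] with x hx using mem_Ioi.2 (sub_pos.2 (mem_Ioi.1 hx))
  refine tendsto_atTop_mono' _ ?_
    ((tendsto_inv_nhdsGT_zero.comp hsub).const_mul_atTop (hw j))
  filter_upwards [self_mem_nhdsWithin] with x hx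
  have hterm : ∀ i ∈ Finset.univ, 0 ≤ w i / (x - a i) := fun i _ =>
    div_nonneg (hw i).le (sub_pos.2 ((ha i).trans_lt hx)).le
  have h := Finset.single_le_sum hterm (Finset.mem_univ j)
  simpa [hj, div_eq_mul_inv] using h

end PoleSum

/-- On `(σ_max², ∞)` the function `B` is strictly increasing, tends to `-∞` at
`σ_max²⁺` and to `1` at `∞`; consequently `B` has a unique zero `β` there, with
`B < 0` on `(σ_max², β)`, `B > 0` on `(β, ∞)`, and `β` is the largest real root of `B`. -/
theorem stmt_6 (L : ℕ) (hL : 0 < L) (c θ : ℝ) (hc : 1 < c) (hθ : 0 < θ)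
    (σ p : Fin L → ℝ) (hσ : ∀ ℓ, 0 < σ ℓ) (hp : ∀ ℓ, 0 < p ℓ)
    (hpsum : ∑ ℓ, p ℓ = 1)
    (B : ℝ → ℝ)
    (hB : ∀ x : ℝ, B x = 1 - c * θ ^ 2 * ∑ ℓ, p ℓ / (x - σ ℓ ^ 2))
    (smax : ℝ)
    (hsmax : smax = Finset.univ.sup' ⟨⟨0, hL⟩, Finset.mem_univ _⟩ (fun ℓ => σ ℓ ^ 2)) :
    StrictMonoOn B (Ioi smax) ∧
    Tendsto B (nhdsWithin smax (Ioi smax)) atBot ∧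
    Tendsto B atTop (nhds 1) ∧
    (∃! β : ℝ, β ∈ Ioi smax ∧ B β = 0) ∧
    (∀ β : ℝ, β ∈ Ioi smax → B β = 0 →
      (∀ x ∈ Ioo smax β, B x < 0) ∧ (∀ x ∈ Ioi β, 0 < B x) ∧
      (∀ x : ℝ, (∀ ℓ, x ≠ σ ℓ ^ 2) → B x = 0 → x ≤ β)) := by
  have : Nonempty (Fin L) := ⟨⟨0, hL⟩⟩
  have ha : ∀ ℓ, σ ℓ ^ 2 ≤ smax := fun ℓ =>
    hsmax ▸ Finset.le_sup' (fun ℓ => σ ℓ ^ 2) (Finset.mem_univ ℓ)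
  have hm : ∃ ℓ, σ ℓ ^ 2 = smax := by
    obtain ⟨ℓ, -, h⟩ := Finset.exists_mem_eq_sup' (Finset.univ_nonempty (α := Fin L))
      (fun ℓ => σ ℓ ^ 2)
    exact ⟨ℓ, h.symm.trans hsmax.symm⟩
  have hk : 0 < c * θ ^ 2 := by positivity
  obtain rfl : B = fun x => 1 - c * θ ^ 2 * ∑ ℓ, p ℓ / (x - σ ℓ ^ 2) := funext hB
  have hmono : StrictMonoOn (fun x => 1 - c * θ ^ 2 * ∑ ℓ, p ℓ / (x - σ ℓ ^ 2)) (Ioi smax) :=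
    fun x hx y hy hxy => sub_lt_sub_left
      (mul_lt_mul_of_pos_left (strictAntiOn_sum_div_sub hp ha hx hy hxy) hk) 1
  have hbot : Tendsto (fun x => 1 - c * θ ^ 2 * ∑ ℓ, p ℓ / (x - σ ℓ ^ 2))
      (nhdsWithin smax (Ioi smax)) atBot := by
    simpa only [sub_eq_add_neg, Function.comp_def] using tendsto_atBot_add_const_left _ (1 : ℝ)
      (tendsto_neg_atTop_atBot.comp
        ((tendsto_sum_div_sub_nhdsGT hp ha hm).const_mul_atTop hk))
  have htop : Tendsto (fun x => 1 - c * θ ^ 2 * ∑ ℓ, p ℓ / (x - σ ℓ ^ 2)) atTop (nhds 1) := by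
    simpa using (tendsto_sum_div_sub_atTop.const_mul (c * θ ^ 2)).const_sub 1
  have hcont : ContinuousOn (fun x => 1 - c * θ ^ 2 * ∑ ℓ, p ℓ / (x - σ ℓ ^ 2)) (Ioi smax) :=
    continuousOn_const.sub (continuousOn_const.mul (continuousOn_sum_div_sub ha))
  refine ⟨hmono, hbot, htop, ?_, fun β hβ hβ0 => ⟨fun x hx => ?_, fun x hx => ?_,
    fun x _ hx0 => ?_⟩⟩
  · obtain ⟨x, hx0, hx⟩ :=
      ((hbot.eventually_lt_atBot 0).and self_mem_nhdsWithin).exists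
    obtain ⟨y, hy0, hy⟩ :=
      ((htop.eventually_const_lt one_pos).and (eventually_gt_atTop smax)).exists
    obtain ⟨β, hβ, hβ0⟩ :=
      isPreconnected_Ioi.intermediate_value hx hy hcont ⟨hx0.le, hy0.le⟩
    exact ⟨β, ⟨hβ, hβ0⟩, fun z hz => hmono.injOn hz.1 hβ (hz.2.trans hβ0.symm)⟩
  · exact (hmono hx.1 hβ hx.2).trans_eq hβ0
  · exact hβ0.symm.trans_lt (hmono hβ (Ioi_subset_Ioi (mem_Ioi.1 hβ).le hx) hx)
  · by_contra! h
    exact (hβ0.symm.trans_lt (hmono hβ (mem_Ioi.2 (lt_trans hβ h)) h)).ne' hx0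
end

section
/- Let α be the unique zero of A in (σ_max², ∞), β the unique zero of B in (σ_max², ∞), and B′(β) = c·θ²·Σ_{ℓ=1}^L p_ℓ/(β − σ_ℓ²)². Then the piecewise expression equal to A(β)/(β·B′(β)) when B(α) < 0 and equal to 0 otherwise coincides with max(0, A(β)/(β·B′(β))). -/
open Set

/-- A sum of positively weighted inverse powers with poles at the `s i` is strictly decreasing to
the right of all of its poles. -/
theorem strictAntiOn_sum_div_sub_pow {ι : Type*} [Fintype ι] [Nonempty ι] {w s : ι → ℝ} {m : ℝ}
    (hw : ∀ i, 0 < w i) (hs : ∀ i, s i ≤ m) {k : ℕ} (hk : k ≠ 0) :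
    StrictAntiOn (fun x => ∑ i, w i / (x - s i) ^ k) (Ioi m) := by
  intro x hx y _ hxy
  refine Finset.sum_lt_sum_of_nonempty Finset.univ_nonempty fun i _ => ?_
  have hxi : 0 < x - s i := sub_pos.2 ((hs i).trans_lt hx)
  exact div_lt_div_of_pos_left (hw i) (pow_pos hxi k)
    (pow_lt_pow_left₀ (sub_lt_sub_right hxy _) hxi.le hk)

/-- The piecewise expression equal to `A(β)/(β B'(β))` when `B(α) < 0` and `0`
otherwise coincides with `max 0 (A(β)/(β B'(β)))`. -/
theorem stmt_10 (L : ℕ) (hL : 0 < L) (c θ : ℝ) (hc : 1 < c) (hθ : 0 < θ)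
    (σ p : Fin L → ℝ) (hσ : ∀ ℓ, 0 < σ ℓ) (hp : ∀ ℓ, 0 < p ℓ)
    (hpsum : ∑ ℓ, p ℓ = 1)
    (A B : ℝ → ℝ)
    (hA : ∀ x : ℝ, A x = 1 - c * ∑ ℓ, p ℓ * σ ℓ ^ 4 / (x - σ ℓ ^ 2) ^ 2)
    (hB : ∀ x : ℝ, B x = 1 - c * θ ^ 2 * ∑ ℓ, p ℓ / (x - σ ℓ ^ 2))
    (smax : ℝ)
    (hsmax : smax = Finset.univ.sup' ⟨⟨0, hL⟩, Finset.mem_univ _⟩ (fun ℓ => σ ℓ ^ 2))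
    (α : ℝ) (hα : α ∈ Ioi smax) (hAα : A α = 0)
    (β : ℝ) (hβ : β ∈ Ioi smax) (hBβ : B β = 0)
    (B'β : ℝ) (hB'β : B'β = c * θ ^ 2 * ∑ ℓ, p ℓ / (β - σ ℓ ^ 2) ^ 2) :
    (if B α < 0 then A β / (β * B'β) else 0) = max 0 (A β / (β * B'β)) := by
  have : Nonempty (Fin L) := ⟨⟨0, hL⟩⟩
  have hc0 : 0 < c := one_pos.trans hc
  have hs : ∀ ℓ, σ ℓ ^ 2 ≤ smax := fun ℓ => by
    rw [hsmax]
    exact Finset.le_sup' (fun ℓ => σ ℓ ^ 2) (Finset.mem_univ ℓ)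
  have hA_mono : StrictMonoOn A (Ioi smax) := fun x hx y hy hxy => by
    rw [hA, hA]
    exact sub_lt_sub_left (mul_lt_mul_of_pos_left
      (strictAntiOn_sum_div_sub_pow (fun ℓ => mul_pos (hp ℓ) (pow_pos (hσ ℓ) 4)) hs two_ne_zero
        hx hy hxy) hc0) 1
  have hB_mono : StrictMonoOn B (Ioi smax) := fun x hx y hy hxy => by
    have h := strictAntiOn_sum_div_sub_pow hp hs one_ne_zero hx hy hxy
    simp only [pow_one] at h
    rw [hB, hB]
    exact sub_lt_sub_left (mul_lt_mul_of_pos_left h (by positivity)) 1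
  have hβ0 : 0 ≤ β := (sq_nonneg (σ ⟨0, hL⟩)).trans ((hs _).trans (le_of_lt hβ))
  have hden : 0 ≤ β * B'β := by
    rw [hB'β]
    exact mul_nonneg hβ0 (mul_nonneg (by positivity)
      (Finset.sum_nonneg fun ℓ _ => div_nonneg (hp ℓ).le (sq_nonneg _)))
  have hB_iff : B α < 0 ↔ α < β := by rw [← hBβ, hB_mono.lt_iff_lt hα hβ]
  split_ifs with h
  · have hAβ : 0 < A β := hAα ▸ hA_mono hα hβ (hB_iff.1 h)
    exact (max_eq_right (div_nonneg hAβ.le hden)).symm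
  · have hAβ : A β ≤ 0 :=
      hAα ▸ (hA_mono.le_iff_le hβ hα).2 (not_lt.1 fun hlt => h (hB_iff.2 hlt))
    exact (max_eq_left (div_nonpos_of_nonpos_of_nonneg hAβ hden)).symm
end

section
/- Suppose the noise variances are strictly ordered: σ_1² < σ_2² < ⋯ < σ_L². Then for each ℓ ∈ {1, …, L − 1}, the function B has exactly one zero in the open interval (σ_ℓ², σ_{ℓ+1}²). -/
open Set

open Filter Topology

section PoleSum

variable {ι : Type*} [Fintype ι] {p s : ι → ℝ}

/-- Isolating one pole: the remaining terms are continuous there. -/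
lemma tendsto_sum_div_sub_erase [DecidableEq ι] (hs : Function.Injective s) (i : ι) :
    Tendsto (fun x ↦ ∑ k ∈ Finset.univ.erase i, p k / (x - s k)) (𝓝 (s i))
      (𝓝 (∑ k ∈ Finset.univ.erase i, p k / (s i - s k))) := by
  refine tendsto_finsetSum _ fun k hk ↦ ?_
  refine tendsto_const_nhds.div (tendsto_id.sub tendsto_const_nhds) ?_
  exact sub_ne_zero.mpr (hs.ne (Finset.ne_of_mem_erase hk).symm)

lemma tendsto_sum_div_sub_atTop_s11 (hs : Function.Injective s) {i : ι} (hp : 0 < p i) :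
    Tendsto (fun x ↦ ∑ k, p k / (x - s k)) (𝓝[>] (s i)) atTop := by
  classical
  have hsub : Tendsto (fun x ↦ x - s i) (𝓝[>] (s i)) (𝓝[>] 0) := by
    refine tendsto_nhdsWithin_iff.mpr ⟨?_, ?_⟩
    · exact ((continuous_sub_right (s i)).tendsto' _ _ (sub_self _)).mono_left
        nhdsWithin_le_nhds
    · filter_upwards [self_mem_nhdsWithin] with x hx using mem_Ioi.mpr (sub_pos.mpr (mem_Ioi.mp hx))
  have hpole := (tendsto_inv_nhdsGT_zero.comp hsub).const_mul_atTop hp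
  refine (hpole.atTop_add
    ((tendsto_sum_div_sub_erase (p := p) hs i).mono_left nhdsWithin_le_nhds)).congr fun x ↦ ?_
  rw [← Finset.add_sum_erase _ _ (Finset.mem_univ i), div_eq_mul_inv, Function.comp_apply]

lemma tendsto_sum_div_sub_atBot (hs : Function.Injective s) {i : ι} (hp : 0 < p i) :
    Tendsto (fun x ↦ ∑ k, p k / (x - s k)) (𝓝[<] (s i)) atBot := by
  classical
  have hsub : Tendsto (fun x ↦ x - s i) (𝓝[<] (s i)) (𝓝[<] 0) := by
    refine tendsto_nhdsWithin_iff.mpr ⟨?_, ?_⟩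
    · exact ((continuous_sub_right (s i)).tendsto' _ _ (sub_self _)).mono_left
        nhdsWithin_le_nhds
    · filter_upwards [self_mem_nhdsWithin] with x hx using mem_Iio.mpr (sub_neg.mpr (mem_Iio.mp hx))
  have hpole := (tendsto_inv_nhdsLT_zero.comp hsub).const_mul_atBot hp
  refine (hpole.atBot_add
    ((tendsto_sum_div_sub_erase (p := p) hs i).mono_left nhdsWithin_le_nhds)).congr fun x ↦ ?_
  rw [← Finset.add_sum_erase _ _ (Finset.mem_univ i), div_eq_mul_inv, Function.comp_apply]

lemma strictAntiOn_sum_div_sub_s11 [Nonempty ι] (hp : ∀ k, 0 < p k) {a b : ℝ}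
    (hgap : ∀ k, s k ≤ a ∨ b ≤ s k) :
    StrictAntiOn (fun x ↦ ∑ k, p k / (x - s k)) (Ioo a b) := by
  intro x hx y hy hxy
  refine Finset.sum_lt_sum_of_nonempty Finset.univ_nonempty fun k _ ↦ ?_
  simp only [div_eq_mul_inv]
  refine mul_lt_mul_of_pos_left ?_ (hp k)
  rcases hgap k with hk | hk
  · exact inv_strictAnti₀ (by linarith [hx.1]) (by linarith)
  · exact (inv_lt_inv_of_neg (by linarith [hy.2]) (by linarith [hx.2])).mpr (by linarith)

/-- Between two consecutive poles, a sum of simple poles with positive weights takes every real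
value exactly once. -/
lemma existsUnique_sum_div_sub_eq (hs : Function.Injective s) (hp : ∀ k, 0 < p k) {i j : ι}
    (hij : s i < s j) (hgap : ∀ k, s k ≤ s i ∨ s j ≤ s k) (t : ℝ) :
    ∃! x, x ∈ Ioo (s i) (s j) ∧ ∑ k, p k / (x - s k) = t := by
  have : Nonempty ι := ⟨i⟩
  have hcont : ContinuousOn (fun x ↦ ∑ k, p k / (x - s k)) (Ioo (s i) (s j)) := by
    refine continuousOn_finsetSum _ fun k _ ↦
      continuousOn_const.div (continuousOn_id.sub continuousOn_const) fun x hx ↦ ?_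
    rcases hgap k with hk | hk
    · exact (sub_pos.mpr (hk.trans_lt hx.1)).ne'
    · exact (sub_neg.mpr (hx.2.trans_le hk)).ne
  obtain ⟨x, hx, hxt⟩ := isPreconnected_Ioo.intermediate_value_Iii
    (le_principal_iff.mpr (Ioo_mem_nhdsLT hij)) (le_principal_iff.mpr (Ioo_mem_nhdsGT hij))
    hcont (tendsto_sum_div_sub_atBot hs (hp j)) (tendsto_sum_div_sub_atTop_s11 hs (hp i))
    (mem_univ t)
  exact ⟨x, ⟨hx, hxt⟩, fun y hy ↦
    (strictAntiOn_sum_div_sub_s11 hp hgap).injOn hy.1 hx (hy.2.trans hxt.symm)⟩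

end PoleSum

/-- If the noise variances are strictly ordered, then between each pair of
consecutive variances `(σ ℓ ^ 2, σ (ℓ+1) ^ 2)` the function `B` has exactly one zero. -/
theorem stmt_11 (L : ℕ) (hL : 0 < L) (c θ : ℝ) (hc : 1 < c) (hθ : 0 < θ)
    (σ p : Fin L → ℝ) (hσ : ∀ ℓ, 0 < σ ℓ) (hp : ∀ ℓ, 0 < p ℓ)
    (hpsum : ∑ ℓ, p ℓ = 1)
    (B : ℝ → ℝ)
    (hB : ∀ x : ℝ, B x = 1 - c * θ ^ 2 * ∑ ℓ, p ℓ / (x - σ ℓ ^ 2))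
    (hord : ∀ i j : Fin L, i < j → σ i ^ 2 < σ j ^ 2) :
    ∀ i : Fin L, ∀ h : (i : ℕ) + 1 < L,
      ∃! x : ℝ, x ∈ Ioo (σ i ^ 2) (σ ⟨(i : ℕ) + 1, h⟩ ^ 2) ∧ B x = 0 := by
  intro i h
  have hmono : StrictMono fun k ↦ σ k ^ 2 := fun k l hkl ↦ hord k l hkl
  have hgap : ∀ k, σ k ^ 2 ≤ σ i ^ 2 ∨ σ ⟨(i : ℕ) + 1, h⟩ ^ 2 ≤ σ k ^ 2 := by
    intro k
    rcases le_or_gt k i with hk | hk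
    · exact Or.inl (hmono.monotone hk)
    · exact Or.inr (hmono.monotone (Nat.succ_le_of_lt hk))
  have hcθ : c * θ ^ 2 ≠ 0 := by positivity
  have hzero : ∀ x, B x = 0 ↔ ∑ k, p k / (x - σ k ^ 2) = 1 / (c * θ ^ 2) := by
    intro x
    rw [hB, sub_eq_zero, eq_div_iff hcθ, mul_comm, eq_comm]
  simp only [hzero]
  exact existsUnique_sum_div_sub_eq hmono.injective hp (hord _ _ (Nat.lt_succ_self _)) hgap _
end
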